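/- arXiv:1901.02922 — 2 statements merged into one kernel-verified Lean document; each statement's English description precedes it below -/
import Mathlib

section
/- Let G = ℤ^m × F_n and let H ≤ G be finitely generated with r(Hπ) ≥ 2 and [ℤ^m : L_H] = l < ∞ where L_H = H ∩ ℤ^m. Then di_G(H) ≤ l · di_{F_n}(Hπ). -/
noncomputable section

def grank {G : Type*} [Group G] (H : Subgroup G) : ℕ∞ :=
  ⨅ (S : Set G) (_ : Subgroup.closure S = H), S.encard

def rrank {G : Type*} [Group G] (H : Subgroup G) : ℕ∞ := grank H - 1

def erat (a b : ℕ∞) : ENNReal := if a = 0 ∧ b = 0 then 1 else (a : ENNReal) / (b : ENNReal)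

def dc {G : Type*} [Group G] (H : Subgroup G) : ENNReal :=
  ⨆ (K : Subgroup G) (_ : K.FG ∧ H ≤ K), erat (rrank H) (rrank K)

def di {G : Type*} [Group G] (H : Subgroup G) : ENNReal :=
  ⨆ (K : Subgroup G) (_ : K.FG ∧ (H ⊓ K).FG), erat (rrank (H ⊓ K)) (rrank K)


theorem grank_le {G : Type*} [Group G] {H : Subgroup G} {S : Set G}
    (h : Subgroup.closure S = H) : grank H ≤ S.encard :=
  iInf₂_le S h

theorem grank_exists {G : Type*} [Group G] (H : Subgroup G) :
    ∃ S : Set G, Subgroup.closure S = H ∧ S.encard = grank H := by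
  have hne : Nonempty {S : Set G // Subgroup.closure S = H} := ⟨⟨H, Subgroup.closure_eq H⟩⟩
  obtain ⟨S, hS⟩ := ENat.exists_eq_iInf (fun S : {S : Set G // Subgroup.closure S = H} => S.1.encard)
  refine ⟨S.1, S.2, ?_⟩
  rw [hS, grank, iInf_subtype]

theorem grank_ne_top {G : Type*} [Group G] {H : Subgroup G} (h : H.FG) : grank H ≠ ⊤ := by
  obtain ⟨S, hS⟩ := h
  have := grank_le hS
  rw [Set.encard_coe_eq_coe_finsetCard] at this
  exact ne_top_of_le_ne_top (ENat.natCast_ne_top _) this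

theorem schreier_tree {P : Type*} [Group P] (N : Subgroup P) [N.FiniteIndex]
    (S : Finset P) (hS : Subgroup.closure (S : Set P) = ⊤) (k : ℕ)
    (hk : k + 1 ≤ N.index) :
    ∃ (A : Finset (P ⧸ N)) (t : P ⧸ N → P) (E : Finset ((P ⧸ N) × P)),
      A.card = k + 1 ∧ E.card = k ∧ ((1 : P) : P ⧸ N) ∈ A ∧ t ((1 : P) : P ⧸ N) = 1 ∧
      (∀ x ∈ A, t x • ((1 : P) : P ⧸ N) = x) ∧
      ∀ e ∈ E, e.2 ∈ S ∧ e.1 ∈ A ∧ e.2 • e.1 ∈ A ∧ t (e.2 • e.1) = e.2 * t e.1 := by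
  classical
  induction k with
  | zero =>
    refine ⟨{((1 : P) : P ⧸ N)}, fun _ => 1, ∅, by simp, by simp, by simp, rfl, ?_, by simp⟩
    intro x hx
    rw [Finset.mem_singleton.1 hx, one_smul]
  | succ k ih =>
    obtain ⟨A, t, E, hA, hE, h1A, ht1, htA, hEt⟩ := ih (by omega)
    have hex : ∃ s ∈ S, ∃ x : P ⧸ N, ¬ (x ∈ A ↔ s • x ∈ A) := by
      by_contra hcon
      push Not at hcon
      have key : ∀ g : P, ∀ x : P ⧸ N, x ∈ A ↔ g • x ∈ A := by
        intro g
        have hg : g ∈ Subgroup.closure (S : Set P) := by rw [hS]; trivial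
        induction hg using Subgroup.closure_induction with
        | mem s hs => exact hcon s hs
        | one => intro x; rw [one_smul]
        | mul a b _ _ ha hb => intro x; rw [hb x, ha (b • x), mul_smul]
        | inv a _ ha => intro x; rw [ha (a⁻¹ • x), smul_inv_smul]
      have hall : ∀ x : P ⧸ N, x ∈ A := by
        intro x
        obtain ⟨g, rfl⟩ := QuotientGroup.mk_surjective x
        have := (key g ((1 : P) : P ⧸ N)).1 h1A
        simpa using this
      have hc : Nat.card (P ⧸ N) = k + 1 := by
        rw [← hA, ← Nat.card_congr (Equiv.subtypeUnivEquiv hall)]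
        simp
      rw [Subgroup.index] at hk
      omega
    obtain ⟨s, hs, x, hx⟩ := hex
    have hnE : (x, s) ∉ E := by
      intro h
      obtain ⟨-, h1, h2, -⟩ := hEt _ h
      exact hx ⟨fun _ => h2, fun _ => h1⟩
    by_cases hxA : x ∈ A
    · have hy : s • x ∉ A := fun h => hx ⟨fun _ => h, fun _ => hxA⟩
      have hne : ∀ z ∈ A, z ≠ s • x := fun z hz h => hy (h ▸ hz)
      refine ⟨insert (s • x) A, Function.update t (s • x) (s * t x), insert (x, s) E, ?_, ?_, ?_, ?_, ?_, ?_⟩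
      · rw [Finset.card_insert_of_notMem hy, hA]
      · rw [Finset.card_insert_of_notMem hnE, hE]
      · exact Finset.mem_insert_of_mem h1A
      · rw [Function.update_of_ne (hne _ h1A), ht1]
      · intro z hz
        rcases Finset.mem_insert.1 hz with rfl | hz
        · rw [Function.update_self, mul_smul, htA x hxA]
        · rw [Function.update_of_ne (hne _ hz), htA z hz]
      · intro e he
        rcases Finset.mem_insert.1 he with rfl | he
        · refine ⟨hs, Finset.mem_insert_of_mem hxA, Finset.mem_insert_self _ _, ?_⟩
          dsimp only
          rw [Function.update_self, Function.update_of_ne (hne _ hxA)]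
        · obtain ⟨a, b, c, d⟩ := hEt e he
          refine ⟨a, Finset.mem_insert_of_mem b, Finset.mem_insert_of_mem c, ?_⟩
          rw [Function.update_of_ne (hne _ c), Function.update_of_ne (hne _ b), d]
    · have hy : s • x ∈ A := by
        by_contra h
        exact hx ⟨fun h' => absurd h' hxA, fun h' => absurd h' h⟩
      have hne : ∀ z ∈ A, z ≠ x := fun z hz h => hxA (h ▸ hz)
      refine ⟨insert x A, Function.update t x (s⁻¹ * t (s • x)), insert (x, s) E, ?_, ?_, ?_, ?_, ?_, ?_⟩
      · rw [Finset.card_insert_of_notMem hxA, hA]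
      · rw [Finset.card_insert_of_notMem hnE, hE]
      · exact Finset.mem_insert_of_mem h1A
      · rw [Function.update_of_ne (hne _ h1A), ht1]
      · intro z hz
        rcases Finset.mem_insert.1 hz with rfl | hz
        · rw [Function.update_self, mul_smul, htA _ hy, inv_smul_smul]
        · rw [Function.update_of_ne (hne _ hz), htA z hz]
      · intro e he
        rcases Finset.mem_insert.1 he with rfl | he
        · refine ⟨hs, Finset.mem_insert_self _ _, Finset.mem_insert_of_mem hy, ?_⟩
          dsimp only
          rw [Function.update_self, Function.update_of_ne (hne _ hy)]
          group
        · obtain ⟨a, b, c, d⟩ := hEt e he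
          refine ⟨a, Finset.mem_insert_of_mem b, Finset.mem_insert_of_mem c, ?_⟩
          rw [Function.update_of_ne (hne _ c), Function.update_of_ne (hne _ b), d]

/-- The Schreier bound: a subgroup of index `j` of an `r`-generated group needs at most
`j * r - j + 1` generators. -/
theorem schreier_bound {P : Type*} [Group P] (N : Subgroup P) [N.FiniteIndex]
    (S : Finset P) (hS : Subgroup.closure (S : Set P) = ⊤) :
    ∃ T : Finset P, Subgroup.closure (T : Set P) = N ∧
      T.card + N.index ≤ N.index * S.card + 1 := by
  classical
  have hpos : N.index ≠ 0 := Subgroup.FiniteIndex.index_ne_zero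
  obtain ⟨A, t, E, hA, hE, h1A, ht1, htA, hEt⟩ := schreier_tree N S hS (N.index - 1) (by omega)
  letI : Fintype (P ⧸ N) := Fintype.ofFinite _
  have hcard : Fintype.card (P ⧸ N) = N.index := by
    rw [Subgroup.index, Nat.card_eq_fintype_card]
  have hAu : A = Finset.univ := by
    apply Finset.eq_univ_of_card
    rw [hcard]; omega
  have ht : ∀ x, t x • ((1 : P) : P ⧸ N) = x := fun x => htA x (by simp [hAu])
  let f : (P ⧸ N) × P → P := fun e => (t (e.2 • e.1))⁻¹ * e.2 * t e.1
  let U : Finset ((P ⧸ N) × P) := Finset.univ ×ˢ S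
  have hEU : E ⊆ U := by
    intro e he
    simp only [U, Finset.mem_product, Finset.mem_univ, true_and]
    exact (hEt e he).1
  refine ⟨(U \ E).image f, ?_, ?_⟩
  · apply le_antisymm
    · rw [Subgroup.closure_le]
      intro g hg
      obtain ⟨e, -, rfl⟩ := Finset.mem_image.1 (Finset.mem_coe.1 hg)
      have h3 : f e • ((1 : P) : P ⧸ N) = ((1 : P) : P ⧸ N) := by
        simp only [f]
        rw [mul_smul, mul_smul, ht, inv_smul_eq_iff, ht]
      have h4 : ((f e : P) : P ⧸ N) = ((1 : P) : P ⧸ N) := by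
        simpa using h3
      have := QuotientGroup.eq.1 h4.symm
      simpa using this
    · set M := Subgroup.closure (((U \ E).image f : Finset P) : Set P) with hM
      have key : ∀ g : P, ∀ x : P ⧸ N, (t (g • x))⁻¹ * g * t x ∈ M := by
        intro g
        have hg : g ∈ Subgroup.closure (S : Set P) := by rw [hS]; trivial
        induction hg using Subgroup.closure_induction with
        | mem s hs =>
          intro x
          by_cases he : (x, s) ∈ E
          · have := (hEt _ he).2.2.2
            dsimp only at this
            rw [this]
            have : (s * t x)⁻¹ * s * t x = 1 := by group
            rw [this]
            exact M.one_mem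
          · apply Subgroup.subset_closure
            rw [Finset.mem_coe, Finset.mem_image]
            refine ⟨(x, s), ?_, rfl⟩
            rw [Finset.mem_sdiff]
            refine ⟨?_, he⟩
            simp only [U, Finset.mem_product, Finset.mem_univ, true_and]
            exact hs
        | one => intro x; simp
        | mul a b _ _ ha hb =>
          intro x
          have := M.mul_mem (ha (b • x)) (hb x)
          rw [mul_smul]
          convert this using 1
          group
        | inv a _ ha =>
          intro x
          have := M.inv_mem (ha (a⁻¹ • x))
          rw [smul_inv_smul] at this
          convert this using 1
          group
      intro g hg
      have h3 := key g ((1 : P) : P ⧸ N)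
      have h4 : g • ((1 : P) : P ⧸ N) = ((1 : P) : P ⧸ N) := by
        have : ((1 : P) : P ⧸ N) = ((g : P) : P ⧸ N) := QuotientGroup.eq.2 (by simpa using hg)
        refine Eq.trans ?_ this.symm
        change ((g * 1 : P) : P ⧸ N) = _
        rw [mul_one]
      rw [h4, ht1] at h3
      simpa using h3
  · have h5 := Finset.card_image_le (s := U \ E) (f := f)
    rw [Finset.card_sdiff_of_subset hEU] at h5
    have h6 : U.card = N.index * S.card := by
      simp only [U, Finset.card_product, Finset.card_univ, hcard]
    have h7 := Finset.card_le_card hEU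
    omega

theorem grank_schreier {G : Type*} [Group G] (N P : Subgroup G) (hNP : N ≤ P) (hP : P.FG)
    (hj : N.relIndex P ≠ 0) :
    grank N + N.relIndex P ≤ N.relIndex P * grank P + 1 := by
  classical
  obtain ⟨S, hS, hSc⟩ := grank_exists P
  have hfin : S.Finite := by
    rw [← Set.encard_ne_top_iff, hSc]; exact grank_ne_top hP
  subst hS
  let S' : Set (Subgroup.closure S) := (↑) ⁻¹' S
  have hS'f : S'.Finite := hfin.preimage Subtype.val_injective.injOn
  have hS' : Subgroup.closure S' = ⊤ := Subgroup.closure_closure_coe_preimage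
  have hS'c : S'.encard ≤ S.encard := by
    rw [← Subtype.val_injective.encard_image]
    exact Set.encard_le_encard (Set.image_preimage_subset _ _)
  have : (N.subgroupOf (Subgroup.closure S)).FiniteIndex := ⟨hj⟩
  obtain ⟨T, hT, hTc⟩ := schreier_bound (N.subgroupOf (Subgroup.closure S)) hS'f.toFinset
    (by rw [Set.Finite.coe_toFinset]; exact hS')
  have hN : Subgroup.closure ((Subgroup.closure S).subtype '' (T : Set (Subgroup.closure S))) = N := by
    rw [← MonoidHom.map_closure, hT, Subgroup.map_subgroupOf_eq_of_le hNP]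
  have h1 : grank N ≤ T.card := by
    refine (grank_le hN).trans ((Set.encard_image_le _ _).trans ?_)
    rw [Set.encard_coe_eq_coe_finsetCard]
  rw [← hSc]
  have h2 : (hS'f.toFinset.card : ℕ∞) ≤ S.encard := by
    rw [← hS'f.encard_eq_coe_toFinset_card]; exact hS'c
  change T.card + N.relIndex (Subgroup.closure S) ≤ N.relIndex (Subgroup.closure S) * _ + 1 at hTc
  calc grank N + (N.relIndex (Subgroup.closure S) : ℕ∞)
      ≤ (T.card : ℕ∞) + N.relIndex (Subgroup.closure S) := by gcongr
    _ ≤ N.relIndex (Subgroup.closure S) * hS'f.toFinset.card + 1 := by exact_mod_cast hTc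
    _ ≤ _ := by gcongr

theorem fg_of_relIndex {G : Type*} [Group G] (N P : Subgroup G) (hNP : N ≤ P) (hN : N.FG)
    (hj : N.relIndex P ≠ 0) : P.FG := by
  have : (N.subgroupOf P).FiniteIndex := ⟨hj⟩
  let R : Set G := Set.range (fun q : P ⧸ N.subgroupOf P => ((q.out : P) : G))
  have hR : R.Finite := Set.finite_range _
  have : P = N ⊔ Subgroup.closure R := by
    apply le_antisymm
    · intro g hg
      let q : P ⧸ N.subgroupOf P := ((⟨g, hg⟩ : P) : P ⧸ N.subgroupOf P)
      have h1 : ((q.out : P) : P ⧸ N.subgroupOf P) = ((⟨g, hg⟩ : P) : P ⧸ N.subgroupOf P) :=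
        QuotientGroup.out_eq' q
      have h2 := QuotientGroup.eq.1 h1
      rw [Subgroup.mem_subgroupOf] at h2
      have h3 : ((q.out : P) : G) ∈ N ⊔ Subgroup.closure R :=
        (le_sup_right : _ ≤ N ⊔ Subgroup.closure R) (Subgroup.subset_closure ⟨q, rfl⟩)
      have h4 := mul_mem h3 ((le_sup_left : N ≤ N ⊔ Subgroup.closure R) h2)
      simpa using h4
    · refine sup_le hNP ?_
      rw [Subgroup.closure_le]
      rintro _ ⟨q, rfl⟩
      exact q.out.2
  rw [this]
  exact hN.sup ⟨hR.toFinset, by simp⟩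

theorem relIndex_bound {A F : Type*} [CommGroup A] [Group F] (H K : Subgroup (A × F))
    (hl : (H.comap (MonoidHom.inl A F)).index ≠ 0) :
    ((H ⊓ K).map (MonoidHom.snd A F)).relIndex
        (H.map (MonoidHom.snd A F) ⊓ K.map (MonoidHom.snd A F)) ≠ 0 ∧
    ((H ⊓ K).map (MonoidHom.snd A F)).relIndex
        (H.map (MonoidHom.snd A F) ⊓ K.map (MonoidHom.snd A F)) ≤
      (H.comap (MonoidHom.inl A F)).index := by
  set L := H.comap (MonoidHom.inl A F) with hL
  set N := (H ⊓ K).map (MonoidHom.snd A F) with hN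
  set P := H.map (MonoidHom.snd A F) ⊓ K.map (MonoidHom.snd A F) with hP
  have hex : ∀ w : P, ∃ a b : A, (a, (w : F)) ∈ H ∧ (b, (w : F)) ∈ K := by
    rintro ⟨w, ⟨⟨a, w1⟩, h1, h1'⟩, ⟨⟨b, w2⟩, h2, h2'⟩⟩
    simp only [MonoidHom.coe_snd] at h1' h2'
    subst h1'; subst h2'
    exact ⟨a, b, h1, h2⟩
  choose a b ha hb using hex
  let f : P → A ⧸ L := fun w => ((a w * (b w)⁻¹ : A) : A ⧸ L)
  have hf : ∀ w w', f w = f w' → w⁻¹ * w' ∈ N.subgroupOf P := by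
    intro w w' h
    have h1 := QuotientGroup.eq.1 h
    rw [hL, Subgroup.mem_comap, MonoidHom.inl_apply] at h1
    have hK := K.mul_mem (K.inv_mem (hb w)) (hb w')
    have hH := H.mul_mem (H.mul_mem (H.inv_mem (ha w)) (ha w')) (H.inv_mem h1)
    have e1 : ((a w, (w : F))⁻¹ * (a w', (w' : F))) * ((a w * (b w)⁻¹)⁻¹ * (a w' * (b w')⁻¹), (1 : F))⁻¹
        = (b w, (w : F))⁻¹ * (b w', (w' : F)) := by
      ext
      · simp only [Prod.fst_mul, Prod.fst_inv]
        rw [mul_inv_eq_iff_eq_mul]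
        simp only [mul_inv, inv_inv]
        have : (b w)⁻¹ * b w' * ((a w)⁻¹ * b w * (a w' * (b w')⁻¹))
          = (a w)⁻¹ * a w' * ((b w)⁻¹ * b w) * (b w' * (b w')⁻¹) := by
          simp only [mul_comm, mul_left_comm, mul_assoc]
        rw [this]; simp
      · simp
    rw [e1] at hH
    rw [Subgroup.mem_subgroupOf]
    exact ⟨_, ⟨hH, hK⟩, by simp⟩
  have : L.FiniteIndex := ⟨hl⟩
  have hinj : Function.Injective (fun q : P ⧸ N.subgroupOf P => f q.out) := by
    intro q q' h
    have := QuotientGroup.eq.2 (hf _ _ h)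
    rwa [QuotientGroup.out_eq', QuotientGroup.out_eq'] at this
  have : Finite (P ⧸ N.subgroupOf P) := Finite.of_injective _ hinj
  constructor
  · exact (Subgroup.finiteIndex_of_finite_quotient (H := N.subgroupOf P)).index_ne_zero
  · exact Nat.card_le_card_of_injective _ hinj

theorem erat_le {a b : ℕ∞} {c : ENNReal} (h1 : 1 ≤ c)
    (h : (a : ENNReal) ≤ c * (b : ENNReal)) : erat a b ≤ c := by
  unfold erat
  split_ifs with h0
  · exact h1
  · exact ENNReal.div_le_of_le_mul h

/-- The lattice `M ∩ ℤ^m`. -/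
def ZLat {m : ℕ} {F : Type*} [Group F] (M : Subgroup (Multiplicative (Fin m → ℤ) × F)) :
    Submodule ℤ (Fin m → ℤ) where
  carrier := {v | (Multiplicative.ofAdd v, (1 : F)) ∈ M}
  add_mem' := by
    intro a b ha hb
    have := M.mul_mem ha hb
    simpa using this
  zero_mem' := by
    exact M.one_mem
  smul_mem' := by
    intro c x hx
    have := M.zpow_mem hx c
    have h2 : (Multiplicative.ofAdd (c • x), (1 : F)) = (Multiplicative.ofAdd x, (1 : F)) ^ c := by
      rw [Prod.pow_mk, one_zpow, ofAdd_zsmul]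
    change (Multiplicative.ofAdd (c • x), (1 : F)) ∈ M
    rw [h2]
    exact this

theorem mem_ZLat {m : ℕ} {F : Type*} [Group F] {M : Subgroup (Multiplicative (Fin m → ℤ) × F)}
    {v : Fin m → ℤ} : v ∈ ZLat M ↔ (Multiplicative.ofAdd v, (1 : F)) ∈ M := Iff.rfl

theorem grank_upper {m : ℕ} {F : Type*} [Group F]
    (M : Subgroup (Multiplicative (Fin m → ℤ) × F)) :
    grank M ≤ (Module.finrank ℤ (ZLat M) : ℕ∞) +
      grank (M.map (MonoidHom.snd (Multiplicative (Fin m → ℤ)) F)) := by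
  obtain ⟨S, hS, hSc⟩ := grank_exists (M.map (MonoidHom.snd (Multiplicative (Fin m → ℤ)) F))
  let b := Module.finBasis ℤ (ZLat M)
  let u : Fin (Module.finrank ℤ (ZLat M)) → Multiplicative (Fin m → ℤ) × F :=
    fun i => (Multiplicative.ofAdd ((b i : ZLat M) : Fin m → ℤ), 1)
  have hex : ∀ w : S, ∃ x ∈ M, x.2 = (w : F) := by
    rintro ⟨w, hw⟩
    have : w ∈ M.map (MonoidHom.snd (Multiplicative (Fin m → ℤ)) F) := by
      rw [← hS]; exact Subgroup.subset_closure hw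
    obtain ⟨x, hx, rfl⟩ := this
    exact ⟨x, hx, rfl⟩
  choose g hgM hg using hex
  have hcl : Subgroup.closure (Set.range u ∪ Set.range g) = M := by
    apply le_antisymm
    · rw [Subgroup.closure_le]
      rintro _ (⟨i, rfl⟩ | ⟨w, rfl⟩)
      · exact (b i).2
      · exact hgM w
    · intro x hx
      have h1 : (Subgroup.closure (Set.range g)).map (MonoidHom.snd (Multiplicative (Fin m → ℤ)) F)
          = Subgroup.closure S := by
        rw [MonoidHom.map_closure]
        congr 1
        ext w
        constructor
        · rintro ⟨_, ⟨w', rfl⟩, rfl⟩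
          rw [MonoidHom.coe_snd, hg]; exact w'.2
        · intro hw
          exact ⟨_, ⟨⟨w, hw⟩, rfl⟩, hg _⟩
      have h2 : x.2 ∈ (Subgroup.closure (Set.range g)).map
          (MonoidHom.snd (Multiplicative (Fin m → ℤ)) F) := by
        rw [h1, hS]; exact ⟨x, hx, rfl⟩
      obtain ⟨y, hy, hyx⟩ := h2
      rw [MonoidHom.coe_snd] at hyx
      have hyM : y ∈ M := by
        have : Subgroup.closure (Set.range g) ≤ M := by
          rw [Subgroup.closure_le]
          rintro _ ⟨w, rfl⟩
          exact hgM w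
        exact this hy
      have h3 : x * y⁻¹ ∈ M := M.mul_mem hx (M.inv_mem hyM)
      have h4 : x * y⁻¹ = (Multiplicative.ofAdd (Multiplicative.toAdd (x * y⁻¹).1), (1 : F)) := by
        ext1
        · simp
        · simp [hyx]
      have h5 : ZLat M ≤ ZLat (Subgroup.closure (Set.range u)) := by
        have : Submodule.span ℤ ((ZLat M).subtype '' Set.range b) = ZLat M := by
          rw [← Submodule.map_span, b.span_eq, Submodule.map_top, Submodule.range_subtype]
        refine this.ge.trans ?_
        rw [Submodule.span_le]
        rintro _ ⟨_, ⟨i, rfl⟩, rfl⟩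
        exact Subgroup.subset_closure ⟨i, rfl⟩
      have h6 : x * y⁻¹ ∈ Subgroup.closure (Set.range u) := by
        rw [h4]
        apply h5
        rw [mem_ZLat, ← h4]
        exact h3
      have h7 := mul_mem (Subgroup.closure_mono (Set.subset_union_left (t := Set.range g)) h6)
        (Subgroup.closure_mono (Set.subset_union_right (s := Set.range u)) hy)
      simpa using h7
  refine (grank_le hcl).trans ((Set.encard_union_le _ _).trans ?_)
  rw [← hSc]
  gcongr
  · rw [← Set.image_univ]
    refine (Set.encard_image_le _ _).trans ?_
    simp
  · rw [← Set.image_univ]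
    refine (Set.encard_image_le _ _).trans ?_
    simp

theorem grank_lower {m n : ℕ}
    (K : Subgroup (Multiplicative (Fin m → ℤ) × FreeGroup (Fin n))) (hK : K.FG) :
    (Module.finrank ℤ (ZLat K) : ℕ∞) +
      grank (K.map (MonoidHom.snd (Multiplicative (Fin m → ℤ)) (FreeGroup (Fin n)))) ≤ grank K := by
  classical
  obtain ⟨S, hS, hSc⟩ := grank_exists K
  have hfin : S.Finite := by
    rw [← Set.encard_ne_top_iff, hSc]; exact grank_ne_top hK
  let f := MonoidHom.snd (Multiplicative (Fin m → ℤ)) (FreeGroup (Fin n))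
  change (Module.finrank ℤ (ZLat K) : ℕ∞) + grank (K.map f) ≤ _
  let ι := IsFreeGroup.Generators (K.map f)
  let e : FreeGroup ι ≃* K.map f := IsFreeGroup.mulEquiv (K.map f)
  let p : K →* FreeGroup ι := e.symm.toMonoidHom.comp (f.subgroupMap K)
  have hp : Function.Surjective p := e.symm.surjective.comp (f.subgroupMap_surjective K)
  choose k hk using fun i : ι => hp (FreeGroup.of i)
  let σ : FreeGroup ι →* K := FreeGroup.lift k
  have hpσ : ∀ w, p (σ w) = w := by
    have : p.comp σ = MonoidHom.id _ := by
      ext i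
      simp [σ, hk]
    intro w
    exact DFunLike.congr_fun this w
  let φ : FreeGroup ι →* Multiplicative (ι →₀ ℤ) :=
    FreeGroup.lift fun i => Multiplicative.ofAdd (Finsupp.single i 1)
  let q : K →* Multiplicative (Fin m → ℤ) := (MonoidHom.fst _ _).comp K.subtype
  let Φ : K → (ι →₀ ℤ) × (Fin m → ℤ) := fun x => (Multiplicative.toAdd (φ (p x)),
    Multiplicative.toAdd (q x) - Multiplicative.toAdd (q (σ (p x))))
  have hΦ1 : Φ 1 = 0 := by simp [Φ]
  have hΦm : ∀ x y, Φ (x * y) = Φ x + Φ y := by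
    intro x y
    ext1
    · simp [Φ]
    · simp only [Φ, map_mul, toAdd_mul, Prod.mk_add_mk]
      abel
  have hΦi : ∀ x, Φ x⁻¹ = - Φ x := by
    intro x
    rw [eq_neg_iff_add_eq_zero, ← hΦm, inv_mul_cancel, hΦ1]
  let S' : Set K := (↑) ⁻¹' S
  have hS' : Subgroup.closure S' = ⊤ := by
    subst hS
    exact Subgroup.closure_closure_coe_preimage
  have hS'c : S'.encard ≤ S.encard := by
    rw [← Subtype.val_injective.encard_image]
    exact Set.encard_le_encard (Set.image_preimage_subset _ _)
  let W : Submodule ℤ ((ι →₀ ℤ) × (Fin m → ℤ)) := Submodule.span ℤ (Φ '' S')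
  have hW : ∀ x, Φ x ∈ W := by
    intro x
    have hx : x ∈ Subgroup.closure S' := by rw [hS']; trivial
    induction hx using Subgroup.closure_induction with
    | mem s hs => exact Submodule.subset_span ⟨s, hs, rfl⟩
    | one => rw [hΦ1]; exact W.zero_mem
    | mul a b _ _ ha hb => rw [hΦm]; exact W.add_mem ha hb
    | inv a _ ha => rw [hΦi]; exact W.neg_mem ha
  have hW1 : ∀ i : ι, ((Finsupp.single i 1, 0) : (ι →₀ ℤ) × (Fin m → ℤ)) ∈ W := by
    intro i
    have h := hW (σ (FreeGroup.of i))
    have h' : Φ (σ (FreeGroup.of i)) = (Finsupp.single i 1, 0) := by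
      simp only [Φ, hpσ, sub_self]
      simp [φ]
    rwa [h'] at h
  have hW1' : ∀ v : ι →₀ ℤ, ((v, 0) : (ι →₀ ℤ) × (Fin m → ℤ)) ∈ W := by
    intro v
    induction v using Finsupp.induction_linear with
    | zero => exact W.zero_mem
    | add a b ha hb => simpa using W.add_mem ha hb
    | single i c =>
      have := W.smul_mem c (hW1 i)
      simpa using this
  have hW2 : ∀ v ∈ ZLat K, ((0, v) : (ι →₀ ℤ) × (Fin m → ℤ)) ∈ W := by
    intro v hv
    have h := hW ⟨_, hv⟩
    have hp1 : p ⟨_, hv⟩ = 1 := by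
      have : f.subgroupMap K ⟨_, hv⟩ = 1 := by
        apply Subtype.ext
        rfl
      change e.symm (f.subgroupMap K ⟨_, hv⟩) = 1
      rw [this, map_one]
    have h' : Φ ⟨_, hv⟩ = (0, v) := by
      simp only [Φ, hp1, map_one]
      simp [q]
    rwa [h'] at h
  let j : ((ι →₀ ℤ) × ZLat K) →ₗ[ℤ] (ι →₀ ℤ) × (Fin m → ℤ) := LinearMap.prodMap LinearMap.id (ZLat K).subtype
  have hj : ∀ x, j x ∈ W := by
    rintro ⟨v, w⟩
    have := W.add_mem (hW1' v) (hW2 w w.2)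
    simpa [j] using this
  have hjinj : Function.Injective (LinearMap.codRestrict W j hj) := by
    rintro ⟨v, w⟩ ⟨v', w'⟩ h
    have h := congrArg Subtype.val h
    simp only [LinearMap.codRestrict_apply, j, LinearMap.prodMap_apply, Prod.mk.injEq] at h
    exact Prod.ext h.1 (Subtype.ext h.2)
  have hr := LinearMap.rank_le_of_injective _ hjinj
  have hS'f : S'.Finite := hfin.preimage Subtype.val_injective.injOn
  have hr2 : Module.rank ℤ W ≤ Cardinal.mk (Φ '' S') := rank_span_le _
  have hr3 := hr.trans (hr2.trans Cardinal.mk_image_le)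
  rw [rank_prod', rank_finsupp_self', ← Module.finrank_eq_rank] at hr3
  have hr4 : ENat.card ι + (Module.finrank ℤ (ZLat K) : ℕ∞) ≤ S'.encard := by
    have : Cardinal.toENat _ ≤ Cardinal.toENat _ := Cardinal.toENat.monotone' hr3
    rw [map_add, Cardinal.toENat_nat] at this
    exact this
  have hg : grank (K.map f) ≤ ENat.card ι := by
    have hcl : Subgroup.closure ((fun w : FreeGroup ι => ((e w : K.map f) : FreeGroup (Fin n))) ''
        Set.range FreeGroup.of) = K.map f := by
      have h1 := MonoidHom.map_closure ((K.map f).subtype.comp e.toMonoidHom) (Set.range FreeGroup.of)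
      rw [FreeGroup.closure_range_of, ← MonoidHom.range_eq_map, MonoidHom.range_comp,
        MonoidHom.range_eq_top.2 e.surjective, ← MonoidHom.range_eq_map, Subgroup.range_subtype] at h1
      exact h1.symm
    refine (grank_le hcl).trans ((Set.encard_image_le _ _).trans ?_)
    rw [← Set.image_univ]
    refine (Set.encard_image_le _ _).trans ?_
    simp
  rw [← hSc]
  calc _ ≤ (Module.finrank ℤ (ZLat K) : ℕ∞) + ENat.card ι := by gcongr
    _ = ENat.card ι + (Module.finrank ℤ (ZLat K) : ℕ∞) := add_comm _ _
    _ ≤ _ := hr4.trans hS'c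

theorem fg_map {G G' : Type*} [Group G] [Group G'] {H : Subgroup G} (h : H.FG) (f : G →* G') :
    (H.map f).FG := by
  classical
  obtain ⟨S, hS⟩ := h
  refine ⟨S.image f, ?_⟩
  rw [Finset.coe_image, ← MonoidHom.map_closure, hS]

theorem grank_bot {G : Type*} [Group G] : grank (⊥ : Subgroup G) = 0 := by
  have := grank_le (Subgroup.closure_empty (G := G))
  simpa using this

theorem eq_bot_of_grank {G : Type*} [Group G] {H : Subgroup G} (h : grank H = 0) : H = ⊥ := by
  obtain ⟨S, hS, hSc⟩ := grank_exists H
  rw [h, Set.encard_eq_zero] at hSc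
  rw [← hS, hSc, Subgroup.closure_empty]

theorem erat_le_one {a b : ℕ∞} (h : a ≤ b) : erat a b ≤ 1 := by
  apply erat_le le_rfl
  rw [one_mul]
  exact_mod_cast h

theorem erat_self {a : ℕ∞} (ha : a ≠ ⊤) : erat a a = 1 := by
  unfold erat
  split_ifs with h0
  · rfl
  · apply ENNReal.div_self
    · simpa using h0
    · simpa using ha

theorem erat_final (rM rK p k rN s j l : ℕ) (d : ENNReal) (hl : l ≠ 0) (hj : j ≤ l)
    (h1 : rM ≤ s + rN) (h2 : s + k ≤ rK) (h3 : rN + j ≤ j * p + 1) (hj0 : j ≠ 0)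
    (hd1 : 1 ≤ d) (hd : erat ((p : ℕ∞) - 1) ((k : ℕ∞) - 1) ≤ d) (hkp : k = 0 → p = 0) :
    erat ((rM : ℕ∞) - 1) ((rK : ℕ∞) - 1) ≤ l * d := by
  have hl1 : (1 : ENNReal) ≤ l := by exact_mod_cast Nat.one_le_iff_ne_zero.2 hl
  have hld : 1 ≤ (l : ENNReal) * d := by
    calc (1 : ENNReal) = 1 * 1 := by simp
      _ ≤ _ := by gcongr
  have c1 : ((rM : ℕ∞) - 1) = ((rM - 1 : ℕ) : ℕ∞) := by simp
  have c2 : ((rK : ℕ∞) - 1) = ((rK - 1 : ℕ) : ℕ∞) := by simp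
  have c3 : ((p : ℕ∞) - 1) = ((p - 1 : ℕ) : ℕ∞) := by simp
  have c4 : ((k : ℕ∞) - 1) = ((k - 1 : ℕ) : ℕ∞) := by simp
  rw [c1, c2]
  rw [c3, c4] at hd
  rcases Nat.eq_zero_or_pos p with hp | hp
  · refine (erat_le_one ?_).trans hld
    subst hp
    have : rM - 1 ≤ rK - 1 := by omega
    exact_mod_cast this
  have hk : 0 < k := by
    rcases Nat.eq_zero_or_pos k with h | h
    · have := hkp h; omega
    · exact h
  obtain ⟨p, rfl⟩ : ∃ p', p = p' + 1 := ⟨p - 1, by omega⟩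
  obtain ⟨k, rfl⟩ : ∃ k', k = k' + 1 := ⟨k - 1, by omega⟩
  simp only [Nat.add_sub_cancel] at hd
  rcases eq_or_ne d ⊤ with rfl | hdt
  · rw [ENNReal.mul_top (by exact_mod_cast hl)]
    exact le_top
  have hpd : (p : ENNReal) ≤ d * k := by
    unfold erat at hd
    split_ifs at hd with h0
    · have : p = 0 := by exact_mod_cast h0.1
      simp [this]
    · simp only [ENat.toENNReal_coe] at hd
      rcases Nat.eq_zero_or_pos k with rfl | hk
      · have hp0 : (p : ENNReal) ≠ 0 := by
          intro h
          apply h0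
          have : p = 0 := by exact_mod_cast h
          simp [this]
        rw [Nat.cast_zero, ENNReal.div_zero hp0] at hd
        exact absurd (top_le_iff.1 hd) hdt
      · rwa [ENNReal.div_le_iff (by exact_mod_cast hk.ne') (by simp)] at hd
  apply erat_le hld
  simp only [ENat.toENNReal_coe]
  have hn : rM - 1 ≤ s + l * p := by
    have : j * p ≤ l * p := Nat.mul_le_mul_right _ hj
    have h4 : j * (p + 1) = j * p + j := by ring
    omega
  have hn2 : s + k ≤ rK - 1 := by omega
  calc ((rM - 1 : ℕ) : ENNReal) ≤ ((s + l * p : ℕ) : ENNReal) := by exact_mod_cast hn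
    _ = 1 * (s : ENNReal) + l * p := by push_cast; ring
    _ ≤ (l * d) * s + l * (d * k) := by gcongr
    _ = l * d * ((s + k : ℕ) : ENNReal) := by push_cast; ring
    _ ≤ _ := by gcongr

theorem di_le_index_mul_di_proj {m n : ℕ}
    (H : Subgroup (Multiplicative (Fin m → ℤ) × FreeGroup (Fin n))) (hH : H.FG)
    (h2 : 2 ≤ grank (H.map (MonoidHom.snd (Multiplicative (Fin m → ℤ)) (FreeGroup (Fin n)))))
    (l : ℕ) (hl0 : l ≠ 0)
    (hl : (H.comap (MonoidHom.inl (Multiplicative (Fin m → ℤ)) (FreeGroup (Fin n)))).index = l) :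
    di H ≤ (l : ENNReal) *
      di (H.map (MonoidHom.snd (Multiplicative (Fin m → ℤ)) (FreeGroup (Fin n)))) := by
  set π := MonoidHom.snd (Multiplicative (Fin m → ℤ)) (FreeGroup (Fin n)) with hπ
  have hH' : (H.map π).FG := fg_map hH π
  have hd1 : 1 ≤ di (H.map π) := by
    have h1 : erat (rrank (H.map π ⊓ H.map π)) (rrank (H.map π)) ≤ di (H.map π) :=
      le_iSup₂_of_le (H.map π) ⟨hH', by rwa [inf_idem]⟩ le_rfl
    rw [inf_idem, erat_self] at h1
    · exact h1
    · exact ne_top_of_le_ne_top (grank_ne_top hH') tsub_le_self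
  refine iSup₂_le ?_
  rintro K ⟨hK, hHK⟩
  obtain ⟨hj0, hj⟩ := relIndex_bound H K (by rw [hl]; exact hl0)
  rw [hl] at hj
  rw [← hπ] at hj0 hj
  have hle : (H ⊓ K).map π ≤ H.map π ⊓ K.map π := Subgroup.map_inf_le H K π
  have hPfg : (H.map π ⊓ K.map π).FG := fg_of_relIndex _ _ hle (fg_map hHK π) hj0
  have hd : erat (rrank (H.map π ⊓ K.map π)) (rrank (K.map π)) ≤ di (H.map π) :=
    le_iSup₂_of_le (K.map π) ⟨fg_map hK π, hPfg⟩ le_rfl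
  have hsch := grank_schreier _ _ hle hPfg hj0
  have hup := grank_upper (H ⊓ K)
  have hlo := grank_lower K hK
  rw [← hπ] at hup hlo
  have hfr : Module.finrank ℤ (ZLat (H ⊓ K)) ≤ Module.finrank ℤ (ZLat K) :=
    Submodule.finrank_mono (fun v hv => hv.2)
  have hkp : grank (K.map π) = 0 → grank (H.map π ⊓ K.map π) = 0 := by
    intro h
    rw [eq_bot_of_grank h, inf_bot_eq, grank_bot]
  unfold rrank at hd ⊢
  obtain ⟨rM, hrM⟩ := ENat.ne_top_iff_exists.1 (grank_ne_top hHK)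
  obtain ⟨rK, hrK⟩ := ENat.ne_top_iff_exists.1 (grank_ne_top hK)
  obtain ⟨p, hp⟩ := ENat.ne_top_iff_exists.1 (grank_ne_top hPfg)
  obtain ⟨k, hk⟩ := ENat.ne_top_iff_exists.1 (grank_ne_top (fg_map hK π))
  obtain ⟨rN, hrN⟩ := ENat.ne_top_iff_exists.1 (grank_ne_top (fg_map hHK π))
  rw [← hrM, ← hrN] at hup
  rw [← hrK, ← hk] at hlo
  rw [← hrN, ← hp] at hsch
  rw [← hp, ← hk] at hd hkp
  rw [← hrM, ← hrK]
  refine erat_final rM rK p k rN _ _ l _ hl0 hj ?_ (by exact_mod_cast hlo)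
    (by exact_mod_cast hsch) hj0 hd1 hd (by exact_mod_cast hkp)
  have : rM ≤ Module.finrank ℤ (ZLat (H ⊓ K)) + rN := by exact_mod_cast hup
  omega
end
end

section
/- Let H ≤ G = ℤ^m × F_n be finitely generated with basis {t^{a₁}u₁, …, t^{a_r}u_r, t^{b₁}, …, t^{b_s}}, and let K be a finitely generated subgroup with H ≤ K ≤ G. Then there exists a finitely generated subgroup K' with H ≤ K' ≤ K such that Hπ is an algebraic extension inside K'π (i.e., Hπ ≤_alg K'π) and r̃(K') ≤ r̃(K). -/
noncomputable section

/-- H is a free factor of K: K is the internal free product of H and some subgroup B. -/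
def IsFreeFactor {F : Type*} [Group F] (H K : Subgroup F) : Prop :=
  ∃ B : Subgroup F,
    Function.Injective (Monoid.Coprod.lift H.subtype B.subtype) ∧
    (Monoid.Coprod.lift H.subtype B.subtype).range = K

/-- H ≤_alg J : the extension is algebraic, i.e. H is contained in no proper free factor of J. -/
def IsAlgebraicExt {F : Type*} [Group F] (H J : Subgroup F) : Prop :=
  H ≤ J ∧ ∀ A : Subgroup F, IsFreeFactor A J → H ≤ A → A = J

lemma grank_range_le {G G' : Type*} [Group G] [Group G'] (K : Subgroup G) (φ : K →* G') :
    grank φ.range ≤ grank K := by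
  unfold grank
  refine le_iInf₂ fun S hS => ?_
  have hSK : S ⊆ K := hS ▸ Subgroup.subset_closure
  have hcl : Subgroup.closure ((↑) ⁻¹' S : Set K) = ⊤ := by
    apply Subgroup.map_injective K.subtype_injective
    rw [MonoidHom.map_closure, ← MonoidHom.range_eq_map, Subgroup.range_subtype]
    have : (K.subtype '' ((↑) ⁻¹' S : Set K)) = S := by
      ext x
      constructor
      · rintro ⟨y, hy, rfl⟩
        exact hy
      · exact fun hx => ⟨⟨x, hSK hx⟩, hx, rfl⟩
    rw [this, hS]
  refine (iInf₂_le (φ '' ((↑) ⁻¹' S : Set K)) ?_).trans ?_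
  · rw [← MonoidHom.map_closure, hcl, MonoidHom.range_eq_map]
  · refine (Set.encard_image_le _ _).trans ?_
    rw [← Subtype.val_injective.encard_image]
    exact Set.encard_le_encard (by simp)

lemma exists_nontrivial_hom {B : Type*} [Group B] [IsFreeGroup B] [Nontrivial B] :
    ∃ f : B →* Multiplicative (ZMod 2), f ≠ 1 := by
  by_cases h : IsEmpty (IsFreeGroup.Generators B)
  · exfalso
    have : Subsingleton B := (IsFreeGroup.toFreeGroup B).toEquiv.subsingleton
    exact not_subsingleton B this
  · rw [not_isEmpty_iff] at h
    obtain ⟨x⟩ := h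
    refine ⟨IsFreeGroup.lift fun _ => Multiplicative.ofAdd 1, fun hf => ?_⟩
    have := DFunLike.congr_fun hf (IsFreeGroup.of x)
    rw [IsFreeGroup.lift_of] at this
    rw [MonoidHom.one_apply] at this
    exact absurd this (by decide)

lemma finite_hom {J : Type*} [Group J] [Group.FG J] :
    Finite (J →* Multiplicative (ZMod 2)) := by
  obtain ⟨S, hS⟩ := Group.fg_def.mp ‹Group.FG J›
  refine Finite.of_injective
    (fun (f : J →* Multiplicative (ZMod 2)) (s : S) => f s) fun f g h => ?_
  refine MonoidHom.eq_of_eqOn_dense hS fun x hx => ?_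
  exact congrFun h ⟨x, hx⟩

/-- A free factor is a retract, of strictly smaller mod-2 cohomology if proper. -/
lemma freeFactor_retract {F : Type*} [Group F] [IsFreeGroup F] (A J : Subgroup F)
    (h : IsFreeFactor A J) (hJ : J.FG) (hne : A ≠ J) :
    A ≤ J ∧ ∃ ρ : J →* A, (∀ (x : J) (hx : (x : F) ∈ A), ρ x = ⟨x, hx⟩) ∧
      Nat.card (A →* Multiplicative (ZMod 2)) < Nat.card (J →* Multiplicative (ZMod 2)) := by
  obtain ⟨B, hinj, hr⟩ := h
  subst hr
  set l := Monoid.Coprod.lift A.subtype B.subtype with hl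
  let e : Monoid.Coprod A B ≃* l.range := MonoidHom.ofInjective hinj
  have hA : A ≤ l.range := fun a ha => ⟨Monoid.Coprod.inl ⟨a, ha⟩, by simp [hl]⟩
  let ρ : l.range →* A := (Monoid.Coprod.fst).comp e.symm.toMonoidHom
  have hρ : ∀ (x : l.range) (hx : (x : F) ∈ A), ρ x = ⟨x, hx⟩ := by
    intro x hx
    have : x = e (Monoid.Coprod.inl ⟨x, hx⟩) := by
      apply Subtype.ext
      simp [e, hl, MonoidHom.ofInjective_apply]
    have h2 : e.symm x = Monoid.Coprod.inl ⟨x, hx⟩ := by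
      rw [MulEquiv.symm_apply_eq]; exact this
    simp [ρ, h2]
  refine ⟨hA, ρ, hρ, ?_⟩
  have hB : Nontrivial B := by
    by_contra hB
    rw [not_nontrivial_iff_subsingleton] at hB
    apply hne
    apply le_antisymm hA
    have : B = ⊥ := (Subgroup.eq_bot_iff_forall _).2 fun x hx =>
      congrArg Subtype.val (Subsingleton.elim (⟨x, hx⟩ : B) 1)
    rw [hl, Monoid.Coprod.range_lift]
    simp [this]
  have : Group.FG l.range := (Group.fg_iff_subgroup_fg _).2 hJ
  have := finite_hom (J := l.range)
  obtain ⟨f, hf⟩ := exists_nontrivial_hom (B := B)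
  have hsec : ∀ a : A, ρ (e (Monoid.Coprod.inl a)) = a := by intro a; simp [ρ]
  have := Fintype.ofFinite (l.range →* Multiplicative (ZMod 2))
  have hinj2 : Function.Injective (fun g : A →* Multiplicative (ZMod 2) => g.comp ρ) := by
    intro g g' hg
    ext a : 1
    have := DFunLike.congr_fun hg (e (Monoid.Coprod.inl a))
    simpa [hsec] using this
  have := Fintype.ofInjective _ hinj2
  rw [Nat.card_eq_fintype_card, Nat.card_eq_fintype_card]
  refine Fintype.card_lt_of_injective_of_notMem _ hinj2
    (b := (Monoid.Coprod.lift 1 f).comp e.symm.toMonoidHom) ?_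
  · rintro ⟨g, hg⟩
    apply hf
    ext b : 1
    have := DFunLike.congr_fun hg (e (Monoid.Coprod.inr b))
    simpa [ρ] using this.symm

lemma step {Z F : Type*} [CommGroup Z] [Group F] [IsFreeGroup F] (K : Subgroup (Z × F))
    (A : Subgroup F) (ρ : K.map (MonoidHom.snd Z F) →* A)
    (hA : A ≤ K.map (MonoidHom.snd Z F))
    (hρ : ∀ (x : K.map (MonoidHom.snd Z F)) (hx : (x : F) ∈ A), ρ x = ⟨x, hx⟩) :
    ∃ φ : K →* Z × F, φ.range = K ⊓ A.comap (MonoidHom.snd Z F) := by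
  let J := K.map (MonoidHom.snd Z F)
  let p : K →* J := (MonoidHom.snd Z F).subgroupMap K
  have hp : Function.Surjective p := (MonoidHom.snd Z F).subgroupMap_surjective K
  have hpv : ∀ k : K, ((p k : J) : F) = (k : Z × F).2 := fun k => rfl
  choose s hs using hp
  let σ : J →* K := IsFreeGroup.lift fun x => s (IsFreeGroup.of x)
  have hσ : ∀ j, p (σ j) = j := by
    have : p.comp σ = MonoidHom.id J := by
      apply IsFreeGroup.ext_hom
      intro a
      simp [σ, IsFreeGroup.lift_of, hs]
    exact fun j => DFunLike.congr_fun this j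
  let τ : J →* K := σ.comp ((Subgroup.inclusion hA).comp ρ)
  have hτ : ∀ j, ((p (τ j) : J) : F) = ρ j := by intro j; simp [τ, hσ]
  have hcent : ∀ k x : K, k * (σ (p k))⁻¹ * x = x * (k * (σ (p k))⁻¹) := by
    intro k x
    have h2 : ((σ (p k) : K) : Z × F).2 = (k : Z × F).2 := by
      rw [← hpv, hσ, hpv]
    apply Subtype.ext
    apply Prod.ext
    · simp [mul_comm]
    · simp [h2]
  let φ : K →* K :=
    { toFun := fun k => k * (σ (p k))⁻¹ * τ (p k)
      map_one' := by simp
      map_mul' := by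
        intro x y
        simp only [map_mul, mul_inv_rev]
        calc x * y * ((σ (p y))⁻¹ * (σ (p x))⁻¹) * (τ (p x) * τ (p y))
            = x * (y * (σ (p y))⁻¹ * ((σ (p x))⁻¹ * τ (p x))) * τ (p y) := by group
          _ = x * (((σ (p x))⁻¹ * τ (p x)) * (y * (σ (p y))⁻¹)) * τ (p y) := by rw [hcent]
          _ = _ := by group }
  have hφ : ∀ k, φ k = k * (σ (p k))⁻¹ * τ (p k) := fun k => rfl
  refine ⟨K.subtype.comp φ, le_antisymm ?_ ?_⟩
  · rintro _ ⟨k, rfl⟩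
    refine ⟨(φ k).2, ?_⟩
    have : ((p (φ k) : J) : F) = ρ (p k) := by
      rw [hφ, map_mul, map_mul, map_inv, hσ, mul_inv_cancel, one_mul, hτ]
    change ((p (φ k) : J) : F) ∈ A
    rw [this]
    exact (ρ (p k)).2
  · rintro x ⟨hx, hxA⟩
    refine ⟨⟨x, hx⟩, ?_⟩
    have h1 : ((p ⟨x, hx⟩ : J) : F) ∈ A := hxA
    have h3 : τ (p ⟨x, hx⟩) = σ (p ⟨x, hx⟩) := by
      simp only [τ, MonoidHom.comp_apply]
      rw [hρ _ h1]
      rfl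
    simp [hφ, h3]

lemma main_aux {Z F : Type*} [CommGroup Z] [Group F] [IsFreeGroup F] (H : Subgroup (Z × F))
    (N : ℕ) : ∀ K : Subgroup (Z × F), K.FG → H ≤ K →
      Nat.card (K.map (MonoidHom.snd Z F) →* Multiplicative (ZMod 2)) = N →
    ∃ K' : Subgroup (Z × F), K'.FG ∧ H ≤ K' ∧ K' ≤ K ∧
      IsAlgebraicExt (H.map (MonoidHom.snd Z F)) (K'.map (MonoidHom.snd Z F)) ∧
      rrank K' ≤ rrank K := by
  induction N using Nat.strong_induction_on with
  | _ N ih =>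
  intro K hK hHK hN
  by_cases halg : IsAlgebraicExt (H.map (MonoidHom.snd Z F)) (K.map (MonoidHom.snd Z F))
  · exact ⟨K, hK, hHK, le_rfl, halg, le_rfl⟩
  have hmap := Subgroup.map_mono (f := MonoidHom.snd Z F) hHK
  simp only [IsAlgebraicExt, hmap, true_and, not_forall] at halg
  obtain ⟨A, hAff, hHA, hne⟩ := halg
  have hJfg : (K.map (MonoidHom.snd Z F)).FG := by
    classical
    obtain ⟨S, hS⟩ := hK
    exact ⟨S.image (MonoidHom.snd Z F), by rw [Finset.coe_image, ← MonoidHom.map_closure, hS]⟩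
  obtain ⟨hAJ, ρ, hρ, hlt⟩ := freeFactor_retract A _ hAff hJfg hne
  obtain ⟨φ, hφ⟩ := step K A ρ hAJ hρ
  have hKA : (K ⊓ A.comap (MonoidHom.snd Z F)).map (MonoidHom.snd Z F) = A := by
    apply le_antisymm
    · rintro _ ⟨x, ⟨_, hx⟩, rfl⟩
      exact hx
    · intro a ha
      obtain ⟨x, hx, rfl⟩ := hAJ ha
      exact ⟨x, ⟨hx, ha⟩, rfl⟩
  have hfg : (K ⊓ A.comap (MonoidHom.snd Z F)).FG := by
    rw [← hφ]
    have : Group.FG K := (Group.fg_iff_subgroup_fg _).2 hK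
    exact (Group.fg_iff_subgroup_fg _).1 inferInstance
  obtain ⟨K', h1, h2, h3, h4, h5⟩ := ih _ (hN ▸ hlt) (K ⊓ A.comap (MonoidHom.snd Z F)) hfg
    (le_inf hHK (Subgroup.map_le_iff_le_comap.1 hHA)) (by rw [hKA])
  refine ⟨K', h1, h2, h3.trans inf_le_left, h4, h5.trans ?_⟩
  rw [← hφ]
  exact tsub_le_tsub_right (grank_range_le K φ) 1

theorem exists_intermediate_with_algebraic_projection {m n : ℕ}
    (H K : Subgroup (Multiplicative (Fin m → ℤ) × FreeGroup (Fin n)))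
    (hH : H.FG) (hK : K.FG) (hHK : H ≤ K) :
    ∃ K' : Subgroup (Multiplicative (Fin m → ℤ) × FreeGroup (Fin n)),
      K'.FG ∧ H ≤ K' ∧ K' ≤ K ∧
      IsAlgebraicExt
        (H.map (MonoidHom.snd (Multiplicative (Fin m → ℤ)) (FreeGroup (Fin n))))
        (K'.map (MonoidHom.snd (Multiplicative (Fin m → ℤ)) (FreeGroup (Fin n)))) ∧
      rrank K' ≤ rrank K := by
  exact main_aux H _ K hK hHK rfl
end
end
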